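/- Let G be a free group of finite rank r > 1 with free generating set S, acting on a standard Borel probability space (X, μ) by μ-preserving Borel automorphisms. Suppose f_G(X, μ) is defined and f_G(X, μ) ≠ −∞. Let M be the set of G-invariant Borel probability measures on X, equipped with the σ-algebra generated by the evaluation maps ν ↦ ν(B) for Borel B ⊆ X, and let τ be a Borel probability measure on M concentrated on the ergodic measures and satisfying μ(B) = ∫ ν(B) dτ(ν) for every Borel B (an ergodic decomposition of μ). Then τ is purely atomic: τ({ν ∈ M : τ({ν}) > 0}) = 1. In particular, the action has only countably many ergodic components. -/

import Mathlib

open MeasureTheory Filter Set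
open scoped ENNReal symmDiff Pointwise

namespace FPaper

/-- The free group of rank `r`; its free generating set `S` is `{FreeGroup.of i | i : Fin r}`. -/
abbrev FG (r : ℕ) := FreeGroup (Fin r)

/-- The reduced `S`-word length of a group element. -/
def wlen {r : ℕ} (g : FG r) : ℕ := g.toWord.length

/-- The ball of radius `n` in `FG r` with respect to the word length. -/
def ball (r n : ℕ) : Set (FG r) := {g | wlen g ≤ n}

instance ballFinite (r n : ℕ) : Finite (ball r n) := by
  have h : ball r n ⊆ FreeGroup.mk '' {l : List (Fin r × Bool) | l.length ≤ n} :=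
    fun g hg => ⟨g.toWord, hg, FreeGroup.mk_toWord⟩
  exact (((List.finite_length_le _ n).image _).subset h).to_subtype

/-- An action of a group `G` on a measurable space `X` by Borel automorphisms. -/
structure BorelAction (G : Type*) [Group G] (X : Type*) [MeasurableSpace X] where
  act : G → X → X
  act_one : ∀ x, act 1 x = x
  act_mul : ∀ g h x, act (g * h) x = act g (act h x)
  measurable_act : ∀ g, Measurable (act g)

namespace BorelAction

variable {G X : Type*} [Group G] [mX : MeasurableSpace X]

/-- The action preserves the measure `μ`. -/
def Preserves (T : BorelAction G X) (μ : Measure X) : Prop :=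
  ∀ g : G, MeasurePreserving (T.act g) μ μ

/-- The translated set `g · B`. -/
def smulSet (T : BorelAction G X) (g : G) (B : Set X) : Set X := T.act g⁻¹ ⁻¹' B

/-- The translated partition `g · α`, where a countable measurable partition is recorded
by a (measurable, countably-valued) function whose fibers are the cells. -/
def tr {I : Type*} (T : BorelAction G X) (g : G) (a : X → I) : X → I :=
  fun x => a (T.act g⁻¹ x)

/-- The join `F · α = ⋁_{f ∈ F} f · α` of the translates of a partition over a set `F ⊆ G`. -/
def joinF {I : Type*} (T : BorelAction G X) (F : Set G) (a : X → I) : X → (F → I) :=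
  fun x f => a (T.act (f : G)⁻¹ x)

/-- The σ-algebra generated by the partitions `f · α`, `f ∈ F`. -/
def partSA {I : Type*} (T : BorelAction G X) (F : Set G) (a : X → I) : MeasurableSpace X :=
  ⨆ f ∈ F, MeasurableSpace.comap (T.tr f a) ⊤

/-- The partition `a` is generating: the smallest `G`-invariant σ-algebra containing `a`
(i.e. the one generated by all translates of `a`) contains every measurable set up to
`ν`-null sets. -/
def Generating {I : Type*} (T : BorelAction G X) (a : X → I) (ν : Measure X) : Prop :=
  ∀ B : Set X, MeasurableSet B →
    ∃ B', MeasurableSet[T.partSA Set.univ a] B' ∧ ν (B ∆ B') = 0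


/-- Ergodicity of the action with respect to `ν`. -/
def IsErgodic (T : BorelAction G X) (ν : Measure X) : Prop :=
  ∀ B : Set X, MeasurableSet B → (∀ g : G, ν (T.smulSet g B ∆ B) = 0) → ν B = 0 ∨ ν B = 1

/-- The action is essentially free with respect to `ν`. -/
def EssentiallyFree (T : BorelAction G X) (ν : Measure X) : Prop :=
  ν {x | ∀ g : G, g ≠ 1 → T.act g x ≠ x} = 1

/-- The stabilizer subgroup of a point. -/
def stab (T : BorelAction G X) (y : X) : Subgroup G where
  carrier := {g | T.act g y = y}
  one_mem' := T.act_one y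
  mul_mem' := by
    intro g h hg hh
    simp only [Set.mem_setOf_eq] at *
    rw [T.act_mul, hh, hg]
  inv_mem' := by
    intro g hg
    simp only [Set.mem_setOf_eq] at *
    conv_lhs => rw [← hg]
    rw [← T.act_mul, inv_mul_cancel, T.act_one]

end BorelAction

/-- `m` is a `G`-invariant sub-σ-algebra. -/
def InvariantSA {G X : Type*} [Group G] (m : MeasurableSpace X) [mX : MeasurableSpace X]
    (T : BorelAction G X) : Prop :=
  m ≤ mX ∧ ∀ (g : G) (B : Set X), MeasurableSet[m] B → MeasurableSet[m] (T.act g ⁻¹' B)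

/-- A measure is purely atomic: the set of atoms has full measure. -/
def PurelyAtomic {X : Type*} [MeasurableSpace X] (ν : Measure X) : Prop :=
  ν {x | 0 < ν {x}} = 1

/-- Shannon entropy of a countable measurable partition (recorded as a countably-valued
function), with values in `[0, ∞]`. -/
noncomputable def Hpart {X I : Type*} [MeasurableSpace X] [Countable I]
    (μ : Measure X) (a : X → I) : ℝ≥0∞ :=
  ∑' i : I, ENNReal.ofReal (Real.negMulLog (μ (a ⁻¹' {i})).toReal)

/-- Conditional Shannon entropy of a countable partition given a sub-σ-algebra `m`:
`H(α/m) = ∫ ∑_{A ∈ α} φ(E[1_A | m](x)) dμ(x)` with `φ(t) = -t log t`. -/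
noncomputable def condEntS {X I : Type*} (m : MeasurableSpace X) [mX : MeasurableSpace X]
    [Countable I] (μ : Measure X) (a : X → I) : ℝ≥0∞ :=
  ∫⁻ x, ∑' i : I,
    ENNReal.ofReal (Real.negMulLog ((μ[(a ⁻¹' {i}).indicator (fun _ => (1:ℝ)) | m]) x)) ∂μ

/-- Conditional Shannon entropy of a partition given another partition:
`H(α/β) = ∑_{B ∈ β} ∑_{A ∈ α} -μ(B) · (μ(A∩B)/μ(B)) · log (μ(A∩B)/μ(B))`
(equivalently `H(α ∨ β) − H(β)`), with values in `[0, ∞]`. -/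
noncomputable def condEntP {X I J : Type*} [MeasurableSpace X] [Countable I] [Countable J]
    (μ : Measure X) (a : X → I) (b : X → J) : ℝ≥0∞ :=
  ∑' q : I × J, μ (b ⁻¹' {q.2}) *
    ENNReal.ofReal (Real.negMulLog
      ((μ (a ⁻¹' {q.1} ∩ b ⁻¹' {q.2})).toReal / (μ (b ⁻¹' {q.2})).toReal))

/-- `F_G(X, μ, S, β) = (1-2r)·H(β) + ∑_{s ∈ S} H(s·β ∨ β)`. -/
noncomputable def FF {r : ℕ} {X I : Type*} [MeasurableSpace X] [Countable I]
    (μ : Measure X) (T : BorelAction (FG r) X) (b : X → I) : ℝ :=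
  (1 - 2 * (r : ℝ)) * (Hpart μ b).toReal
    + ∑ i : Fin r, (Hpart μ (fun x => (T.tr (FreeGroup.of i) b x, b x))).toReal

/-- The sequence `n ↦ F_G(X, μ, S, B_n · α)`. -/
noncomputable def fSeq {r : ℕ} {X : Type*} [MeasurableSpace X]
    (μ : Measure X) (T : BorelAction (FG r) X) (a : X → ℕ) (n : ℕ) : ℝ :=
  FF μ T (T.joinF (ball r n) a)

/-- The f-invariant entropy `f_G(X, μ) = lim_n F_G(X, μ, S, B_n·α)`, the limit (= infimum,
since the sequence is non-increasing) of the sequence `fSeq`, with values in `[-∞, ∞)`. -/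
noncomputable def fInv {r : ℕ} {X : Type*} [MeasurableSpace X]
    (μ : Measure X) (T : BorelAction (FG r) X) (a : X → ℕ) : EReal :=
  ⨅ n : ℕ, ((fSeq μ T a n : ℝ) : EReal)

/-- Relative version `F_G(X, μ/Σ, S, β) = (1-2r)·H(β/Σ) + ∑_{s ∈ S} H(s·β ∨ β / Σ)`. -/
noncomputable def FFrel {r : ℕ} {X I : Type*} (m : MeasurableSpace X) [mX : MeasurableSpace X]
    [Countable I] (μ : Measure X) (T : BorelAction (FG r) X) (b : X → I) : ℝ :=
  (1 - 2 * (r : ℝ)) * (condEntS m μ b).toReal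
    + ∑ i : Fin r, (condEntS m μ (fun x => (T.tr (FreeGroup.of i) b x, b x))).toReal

/-- The sequence `n ↦ F_G(X, μ/Σ, S, B_n · α)`. -/
noncomputable def fSeqRel {r : ℕ} {X : Type*} (m : MeasurableSpace X) [mX : MeasurableSpace X]
    (μ : Measure X) (T : BorelAction (FG r) X) (a : X → ℕ) (n : ℕ) : ℝ :=
  FFrel m μ T (T.joinF (ball r n) a)

/-- The relative f-invariant entropy `f_G(X, μ/Σ)`, with values in `[-∞, ∞)`. -/
noncomputable def fInvRel {r : ℕ} {X : Type*} (m : MeasurableSpace X) [mX : MeasurableSpace X]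
    (μ : Measure X) (T : BorelAction (FG r) X) (a : X → ℕ) : EReal :=
  ⨅ n : ℕ, ((fSeqRel m μ T a n : ℝ) : EReal)

/-- A total order on `S ∪ S⁻¹` is recorded by an injection `ord : Fin r × Bool → ℕ`;
`g ≺ h` iff `|g| < |h|`, or `|g| = |h|` and the reduced word of `g` lexicographically
precedes that of `h`. -/
def wlt {r : ℕ} (ord : Fin r × Bool → ℕ) (g h : FG r) : Prop :=
  wlen g < wlen h ∨ (wlen g = wlen h ∧ List.Lex (fun p q => ord p < ord q) g.toWord h.toWord)

/-- `Pre(g)`: the set of elements strictly preceding `g`. -/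
def Pre {r : ℕ} (ord : Fin r × Bool → ℕ) (g : FG r) : Set (FG r) := {h | wlt ord h g}

/-- The generator or inverse generator corresponding to a letter. -/
def letter {r : ℕ} (p : Fin r × Bool) : FG r :=
  if p.2 then FreeGroup.of p.1 else (FreeGroup.of p.1)⁻¹

/-- The first (leftmost) letter of the reduced word of `g` (junk value `1` for `g = 1`). -/
def firstLetter {r : ℕ} (g : FG r) : FG r := ((g.toWord.head?).map letter).getD 1

/-- The independence decay `δ(g, α/Σ)`, as a real number:
`δ(g, α/Σ) = H(s⁻¹g·α / Pre(s⁻¹g)·α ∨ Σ) − H(g·α / Pre(g)·α ∨ Σ)` where `s` is the first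
letter of `g`. -/
noncomputable def idecay {r : ℕ} {X I : Type*} (m : MeasurableSpace X) [mX : MeasurableSpace X]
    [Countable I] (μ : Measure X) (T : BorelAction (FG r) X)
    (ord : Fin r × Bool → ℕ) (a : X → I) (g : FG r) : ℝ :=
  (condEntS (m ⊔ T.partSA (Pre ord ((firstLetter g)⁻¹ * g)) a) μ
      (T.tr ((firstLetter g)⁻¹ * g) a)).toReal
  - (condEntS (m ⊔ T.partSA (Pre ord g) a) μ (T.tr g a)).toReal

/-- The entropy `H(τ)` of a probability space: the supremum of the Shannon entropies of
finite measurable partitions. -/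
noncomputable def measEnt {M : Type*} [MeasurableSpace M] (τ : Measure M) : ℝ≥0∞ :=
  ⨆ (P : Finset (Set M)) (_ : ∀ p ∈ P, MeasurableSet p)
    (_ : (P : Set (Set M)).PairwiseDisjoint id) (_ : ⋃₀ (P : Set (Set M)) = Set.univ),
    ∑ p ∈ P, ENNReal.ofReal (Real.negMulLog (τ p).toReal)

/-- The non-negative part of an extended real, in `ℝ≥0∞`. -/
noncomputable def erealToENNReal (x : EReal) : ℝ≥0∞ :=
  if x = ⊤ then ⊤ else ENNReal.ofReal x.toReal

/-- The integral of an `EReal`-valued function (positive part minus negative part),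
with values in `[-∞, ∞]`. -/
noncomputable def eIntegral {M : Type*} [MeasurableSpace M] (τ : Measure M) (f : M → EReal) :
    EReal :=
  ((∫⁻ m, erealToENNReal (f m) ∂τ : ℝ≥0∞) : EReal)
    - ((∫⁻ m, erealToENNReal (-(f m)) ∂τ : ℝ≥0∞) : EReal)

/-- The set of `G`-invariant Borel probability measures on `X`. -/
def InvProb {G X : Type*} [Group G] [MeasurableSpace X] (T : BorelAction G X) :
    Set (Measure X) :=
  {ν | IsProbabilityMeasure ν ∧ ∀ g : G, MeasurePreserving (T.act g) ν ν}

lemma Hpart_lt_top {X I : Type*} [MeasurableSpace X] [Finite I] {μ : Measure X}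
    (f : X → I) : Hpart μ f < ⊤ := by
  have := Fintype.ofFinite I
  rw [Hpart, tsum_fintype]
  exact ENNReal.sum_lt_top.2 fun i _ => ENNReal.ofReal_lt_top

lemma ae_measure_fiber_ne_zero {X I : Type*} [MeasurableSpace X] [Countable I] {μ : Measure X}
    (f : X → I) :
    ∀ᵐ x ∂μ, μ (f ⁻¹' {f x}) ≠ 0 := by
  have : {x | ¬ μ (f ⁻¹' {f x}) ≠ 0} = ⋃ i ∈ {i | μ (f ⁻¹' {i}) = 0}, f ⁻¹' {i} := by
    ext x; simp
  rw [ae_iff, this, measure_biUnion_null_iff (Set.to_countable _)]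
  exact fun i hi => hi

section Entropy

variable {X : Type*} [MeasurableSpace X] {μ : Measure X}
  {I J K : Type*} [Countable I] [Countable J]
  [MeasurableSpace I] [MeasurableSingletonClass I]
  [MeasurableSpace J] [MeasurableSingletonClass J]
  [MeasurableSpace K] [MeasurableSingletonClass K]

/-- The information function of a partition. -/
noncomputable def info (μ : Measure X) (f : X → I) (x : X) : ℝ≥0∞ :=
  ENNReal.ofReal (-Real.log (μ (f ⁻¹' {f x})).toReal)

lemma measurable_info {f : X → I} (hf : Measurable f) : Measurable (info μ f) :=
  (measurable_of_countable
    (fun i => ENNReal.ofReal (-Real.log (μ (f ⁻¹' {i})).toReal))).comp hf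

lemma lintegral_comp_countable {f : X → I} (hf : Measurable f) (φ : I → ℝ≥0∞) :
    ∫⁻ x, φ (f x) ∂μ = ∑' i, φ i * μ (f ⁻¹' {i}) := by
  rw [← lintegral_map (measurable_of_countable φ) hf, lintegral_countable']
  refine tsum_congr fun i => ?_
  rw [Measure.map_apply hf (measurableSet_singleton i)]

lemma Hpart_eq_lintegral [IsProbabilityMeasure μ] {f : X → I} (hf : Measurable f) :
    Hpart μ f = ∫⁻ x, info μ f x ∂μ := by
  unfold info
  rw [lintegral_comp_countable hf (fun i => ENNReal.ofReal (-Real.log (μ (f ⁻¹' {i})).toReal))]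
  refine tsum_congr fun i => ?_
  have h1 : (μ (f ⁻¹' {i})).toReal ≤ 1 := measureReal_le_one
  conv_rhs => rw [← ENNReal.ofReal_toReal (measure_ne_top μ (f ⁻¹' {i}))]
  rw [ENNReal.toReal_ofReal ENNReal.toReal_nonneg,
    ← ENNReal.ofReal_mul (by linarith [Real.log_nonpos ENNReal.toReal_nonneg h1]),
    Real.negMulLog]
  congr 1
  ring

/-- A coarser partition has smaller entropy. -/
lemma Hpart_mono [IsProbabilityMeasure μ] {f : X → I} {g : X → J} (hf : Measurable f)
    (hg : Measurable g) (h : ∀ x y, g x = g y → f x = f y) : Hpart μ f ≤ Hpart μ g := by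
  rw [Hpart_eq_lintegral hf, Hpart_eq_lintegral hg]
  refine lintegral_mono_ae ?_
  filter_upwards [ae_measure_fiber_ne_zero (μ := μ) g] with x hx
  refine ENNReal.ofReal_le_ofReal (neg_le_neg (Real.log_le_log
    (ENNReal.toReal_pos hx (measure_ne_top _ _)) ?_))
  exact ENNReal.toReal_mono (measure_ne_top _ _) (measure_mono fun y hy => h y x hy)

lemma Hpart_congr_fibers [IsProbabilityMeasure μ] {f : X → I} {g : X → J} (hf : Measurable f)
    (hg : Measurable g) (h : ∀ x y, g x = g y ↔ f x = f y) : Hpart μ f = Hpart μ g :=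
  le_antisymm (Hpart_mono hf hg fun x y => (h x y).1) (Hpart_mono hg hf fun x y => (h x y).2)

lemma Hpart_comp {f : X → I} (hf : Measurable f) {t : X → X} (ht : MeasurePreserving t μ μ) :
    Hpart μ (f ∘ t) = Hpart μ f := by
  refine tsum_congr fun i => ?_
  rw [preimage_comp, ht.measure_preimage (hf (measurableSet_singleton i)).nullMeasurableSet]

/-- The expected likelihood ratio in the proof of strong subadditivity is at most one. -/
lemma lintegral_likelihood_le_one [IsProbabilityMeasure μ] {f : X → I} {g : X → J} {c : X → K}
    (hf : Measurable f) (hg : Measurable g) (hc : Measurable c)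
    (hfc : ∀ x y, f x = f y → c x = c y) (hgc : ∀ x y, g x = g y → c x = c y) :
    ∫⁻ x, μ (f ⁻¹' {f x}) * μ (g ⁻¹' {g x}) /
      (μ (c ⁻¹' {c x}) * μ ((fun x => (f x, g x)) ⁻¹' {(f x, g x)})) ∂μ ≤ 1 := by
  classical
  obtain ⟨x₀⟩ : Nonempty X := (inferInstance : NeZero μ).out |> fun h => by
    by_contra hX
    rw [not_nonempty_iff] at hX
    exact h (Measure.eq_zero_of_isEmpty μ)
  have : Nonempty K := ⟨c x₀⟩
  obtain ⟨σ, hσ⟩ : ∃ σ : I → K, ∀ x, c x = σ (f x) :=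
    ⟨Function.extend f c fun _ => c x₀, fun x =>
      (Function.FactorsThrough.extend_apply (fun x y => hfc x y) _ x).symm⟩
  obtain ⟨σ', hσ'⟩ : ∃ σ : J → K, ∀ x, c x = σ (g x) :=
    ⟨Function.extend g c fun _ => c x₀, fun x =>
      (Function.FactorsThrough.extend_apply (fun x y => hgc x y) _ x).symm⟩
  have hfg : Measurable fun x => (f x, g x) := hf.prodMk hg
  have hsum : ∀ k, ∑' j, (if σ' j = k then μ (g ⁻¹' {j}) else 0) = μ (c ⁻¹' {k}) := by
    intro k
    have h := lintegral_comp_countable (μ := μ) hg (fun j => if σ' j = k then 1 else 0)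
    simp only [ite_mul, one_mul, zero_mul] at h
    rw [← h, ← lintegral_indicator_one (hc (measurableSet_singleton k))]
    refine lintegral_congr fun x => ?_
    simp [indicator_apply, hσ' x]
  calc ∫⁻ x, μ (f ⁻¹' {f x}) * μ (g ⁻¹' {g x}) /
      (μ (c ⁻¹' {c x}) * μ ((fun x => (f x, g x)) ⁻¹' {(f x, g x)})) ∂μ
      = ∑' p : I × J, μ (f ⁻¹' {p.1}) * μ (g ⁻¹' {p.2}) /
        (μ (c ⁻¹' {σ p.1}) * μ ((fun x => (f x, g x)) ⁻¹' {p})) *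
          μ ((fun x => (f x, g x)) ⁻¹' {p}) := by
        rw [← lintegral_comp_countable hfg (fun p => μ (f ⁻¹' {p.1}) * μ (g ⁻¹' {p.2}) /
          (μ (c ⁻¹' {σ p.1}) * μ ((fun x => (f x, g x)) ⁻¹' {p})))]
        simp only [← hσ]
    _ ≤ ∑' p : I × J, μ (f ⁻¹' {p.1}) / μ (c ⁻¹' {σ p.1}) *
          (if σ' p.2 = σ p.1 then μ (g ⁻¹' {p.2}) else 0) := by
        refine ENNReal.tsum_le_tsum fun p => ?_
        by_cases hp : μ ((fun x => (f x, g x)) ⁻¹' {p}) = 0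
        · simp [hp]
        obtain ⟨x, rfl⟩ := nonempty_of_measure_ne_zero hp
        have hle : μ ((fun x => (f x, g x)) ⁻¹' {(f x, g x)}) ≤ μ (c ⁻¹' {c x}) :=
          measure_mono fun y hy => hfc y x (congrArg Prod.fst hy)
        have hc0 : μ (c ⁻¹' {c x}) ≠ 0 := fun h => hp (by simpa [h] using hle)
        dsimp only
        rw [← hσ, ← hσ', if_pos rfl]
        refine le_of_eq ?_
        simp only [div_eq_mul_inv]
        rw [ENNReal.mul_inv (Or.inl hc0) (Or.inl (measure_ne_top _ _)), mul_assoc,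
          mul_assoc (μ (c ⁻¹' {c x}))⁻¹, ENNReal.inv_mul_cancel hp (measure_ne_top _ _)]
        ring
    _ = ∑' i : I, μ (f ⁻¹' {i}) / μ (c ⁻¹' {σ i}) * μ (c ⁻¹' {σ i}) := by
        rw [ENNReal.tsum_prod']
        refine tsum_congr fun i => ?_
        dsimp only
        rw [ENNReal.tsum_mul_left, hsum]
    _ ≤ ∑' i : I, μ (f ⁻¹' {i}) := ENNReal.tsum_le_tsum fun i => ENNReal.mul_le_of_le_div le_rfl
    _ = 1 := by
        have h := lintegral_comp_countable (μ := μ) hf (fun _ => 1)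
        simpa using h.symm

/-- Strong subadditivity of Shannon entropy. -/
lemma Hpart_submodular [Countable K] [IsProbabilityMeasure μ] {f : X → I} {g : X → J} {c : X → K}
    (hf : Measurable f) (hg : Measurable g) (hc : Measurable c)
    (hfc : ∀ x y, f x = f y → c x = c y) (hgc : ∀ x y, g x = g y → c x = c y) :
    Hpart μ (fun x => (f x, g x)) + Hpart μ c ≤ Hpart μ f + Hpart μ g := by
  have hfg : Measurable fun x => (f x, g x) := hf.prodMk hg
  rw [Hpart_eq_lintegral hf, Hpart_eq_lintegral hg, Hpart_eq_lintegral hc,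
    Hpart_eq_lintegral hfg]
  refine (ENNReal.add_le_add_iff_right (a := 1) ENNReal.one_ne_top).1 ?_
  set L : X → ℝ≥0∞ := fun x => μ (f ⁻¹' {f x}) * μ (g ⁻¹' {g x}) /
      (μ (c ⁻¹' {c x}) * μ ((fun x => (f x, g x)) ⁻¹' {(f x, g x)})) with hL
  have h1 : ∫⁻ x, L x ∂μ ≤ 1 := lintegral_likelihood_le_one hf hg hc hfc hgc
  have hmeas := measurable_info (μ := μ) hfg
  have hmf := measurable_info (μ := μ) hf
  have hmg := measurable_info (μ := μ) hg
  have hmc := measurable_info (μ := μ) hc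
  refine le_trans ?_ (add_le_add_right h1 _)
  calc (∫⁻ x, info μ (fun x => (f x, g x)) x ∂μ) + (∫⁻ x, info μ c x ∂μ) + 1
      = ∫⁻ x, info μ (fun x => (f x, g x)) x + info μ c x + 1 ∂μ := by
        rw [lintegral_add_left (by fun_prop), lintegral_add_left hmeas]
        simp
    _ ≤ ∫⁻ x, info μ f x + info μ g x + L x ∂μ := by
        refine lintegral_mono_ae ?_
        filter_upwards [ae_measure_fiber_ne_zero (μ := μ) (fun x => (f x, g x)),
          ae_measure_fiber_ne_zero (μ := μ) f,
          ae_measure_fiber_ne_zero (μ := μ) g, ae_measure_fiber_ne_zero (μ := μ) c]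
          with x h1 h2 h3 h4
        have p1 := ENNReal.toReal_pos h1 (measure_ne_top μ _)
        have p2 := ENNReal.toReal_pos h2 (measure_ne_top μ _)
        have p3 := ENNReal.toReal_pos h3 (measure_ne_top μ _)
        have p4 := ENNReal.toReal_pos h4 (measure_ne_top μ _)
        have n1 := Real.log_nonpos p1.le (measureReal_le_one (μ := μ))
        have n2 := Real.log_nonpos p2.le (measureReal_le_one (μ := μ))
        have n3 := Real.log_nonpos p3.le (measureReal_le_one (μ := μ))
        have n4 := Real.log_nonpos p4.le (measureReal_le_one (μ := μ))
        have hLx : L x ≠ ⊤ := by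
          refine ENNReal.div_ne_top (ENNReal.mul_ne_top (measure_ne_top _ _) (measure_ne_top _ _))
            (mul_ne_zero h4 h1)
        rw [← ENNReal.ofReal_toReal hLx]
        simp only [info, hL]
        rw [← ENNReal.ofReal_one, ← ENNReal.ofReal_add (by linarith) (by linarith),
          ← ENNReal.ofReal_add (by linarith) (by linarith),
          ← ENNReal.ofReal_add (by linarith) (by linarith),
          ← ENNReal.ofReal_add (by linarith) ENNReal.toReal_nonneg]
        refine ENNReal.ofReal_le_ofReal ?_
        rw [ENNReal.toReal_div, ENNReal.toReal_mul, ENNReal.toReal_mul]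
        have key := Real.log_le_sub_one_of_pos (div_pos (mul_pos p2 p3) (mul_pos p4 p1))
        rw [Real.log_div (mul_pos p2 p3).ne' (mul_pos p4 p1).ne', Real.log_mul p2.ne' p3.ne',
          Real.log_mul p4.ne' p1.ne'] at key
        linarith
    _ = _ := by
        rw [lintegral_add_left (by fun_prop), lintegral_add_left hmf]

/-- Subadditivity of Shannon entropy. -/
lemma Hpart_prod_le [IsProbabilityMeasure μ] {f : X → I} {g : X → J}
    (hf : Measurable f) (hg : Measurable g) :
    Hpart μ (fun x => (f x, g x)) ≤ Hpart μ f + Hpart μ g :=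
  le_self_add.trans (Hpart_submodular (c := fun _ => ()) hf hg measurable_const
    (fun _ _ _ => rfl) fun _ _ _ => rfl)

end Entropy

section SetFunction

variable {r : ℕ}

/-- The analogue of `FF` for a set function on the finite subsets of the free group. -/
noncomputable def setFF (h : Finset (FG r) → ℝ) (K : Finset (FG r)) : ℝ :=
  (1 - 2 * (r : ℝ)) * h K + ∑ i : Fin r, h (K ∪ K.image (FreeGroup.of i * ·))

/-- The ball of radius `n` as a finite set. -/
noncomputable def ballFinset (r n : ℕ) : Finset (FG r) := (Set.toFinite (ball r n)).toFinset

lemma mem_ballFinset {n : ℕ} {g : FG r} : g ∈ ballFinset r n ↔ wlen g ≤ n := by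
  simp [ballFinset, ball]

lemma ballFinset_zero : ballFinset r 0 = {1} := by
  ext g
  simp [mem_ballFinset, wlen, FreeGroup.toWord_eq_nil_iff]

/-- Every element of a ball is a generator or inverse generator times an element of
the preceding ball. -/
lemma exists_letter_mul {n : ℕ} {g : FG r} (hg : wlen g ≤ n + 1) :
    g ∈ ballFinset r n ∨ ∃ (i : Fin r) (g' : FG r), g' ∈ ballFinset r n ∧
      (g = FreeGroup.of i * g' ∨ g = (FreeGroup.of i)⁻¹ * g') := by
  rcases hw : g.toWord with _ | ⟨⟨i, b⟩, l⟩
  · exact Or.inl (mem_ballFinset.2 (by simp [wlen, hw]))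
  · refine Or.inr ⟨i, FreeGroup.mk l, mem_ballFinset.2 ?_, ?_⟩
    · have h1 : (FreeGroup.mk l).norm ≤ l.length := FreeGroup.norm_mk_le
      have h2 : l.length + 1 ≤ n + 1 := by simpa [wlen, hw] using hg
      exact h1.trans (by omega)
    · have hg' : g = FreeGroup.mk ((i, b) :: l) := by rw [← hw, FreeGroup.mk_toWord]
      cases b
      · right
        rw [hg', FreeGroup.of, FreeGroup.inv_mk, FreeGroup.mul_mk]
        rfl
      · left
        rw [hg', FreeGroup.of, FreeGroup.mul_mk]
        rfl

/-- Adjoining to `K` a neighbour of one of its elements does not increase `setFF`. -/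
lemma setFF_insert_le {h : Finset (FG r) → ℝ}
    (hmono : ∀ K L, K ⊆ L → h K ≤ h L)
    (hsub : ∀ K L u, K ⊆ L → h (insert u L) + h K ≤ h (insert u K) + h L)
    (hinv : ∀ g K, h (K.image (g * ·)) = h K)
    {K : Finset (FG r)} {i : Fin r} {u g : FG r} (hg : g ∈ K)
    (hu : u = FreeGroup.of i * g ∨ u = (FreeGroup.of i)⁻¹ * g) :
    setFF h (insert u K) ≤ setFF h K := by
  set x := h (insert u K) - h K with hx
  have hx0 : 0 ≤ x := sub_nonneg.2 (hmono _ _ (Finset.subset_insert _ _))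
  have hsplit : ∀ s : FG r, insert u K ∪ (insert u K).image (s * ·) =
      insert u (insert (s * u) (K ∪ K.image (s * ·))) := by
    intro s; ext v; simp only [Finset.image_insert, Finset.mem_union, Finset.mem_insert]; tauto
  have hfirst : ∀ s : FG r, h (insert u (insert (s * u) (K ∪ K.image (s * ·)))) ≤
      h (insert (s * u) (K ∪ K.image (s * ·))) + x := by
    intro s
    have := hsub K (insert (s * u) (K ∪ K.image (s * ·))) u
      (Finset.subset_union_left.trans (Finset.subset_insert _ _))
    linarith
  have hsecond : ∀ s : FG r, h (insert (s * u) (K ∪ K.image (s * ·))) ≤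
      h (K ∪ K.image (s * ·)) + x := by
    intro s
    have h1 := hsub (K.image (s * ·)) (K ∪ K.image (s * ·)) (s * u) Finset.subset_union_right
    have h2 := hinv s (insert u K)
    rw [Finset.image_insert] at h2
    rw [hinv, h2] at h1
    linarith
  have hterm : ∀ j : Fin r, h (insert u K ∪ (insert u K).image (FreeGroup.of j * ·)) ≤
      h (K ∪ K.image (FreeGroup.of j * ·)) + 2 * x - (if j = i then x else 0) := by
    intro j
    rw [hsplit]
    split_ifs with hj
    · subst hj
      rcases hu with hu | hu
      · have : u ∈ insert (FreeGroup.of j * u) (K ∪ K.image (FreeGroup.of j * ·)) := by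
          rw [Finset.mem_insert, Finset.mem_union]
          exact Or.inr (Or.inr (Finset.mem_image.2 ⟨g, hg, hu.symm⟩))
        rw [Finset.insert_eq_of_mem this]
        linarith [hsecond (FreeGroup.of j)]
      · have : FreeGroup.of j * u ∈ K ∪ K.image (FreeGroup.of j * ·) := by
          rw [hu, mul_inv_cancel_left]
          exact Finset.mem_union_left _ hg
        have h1 := hfirst (FreeGroup.of j)
        rw [Finset.insert_eq_of_mem this] at h1 ⊢
        linarith
    · linarith [hfirst (FreeGroup.of j), hsecond (FreeGroup.of j)]
  have hsum := Finset.sum_le_sum fun j (_ : j ∈ Finset.univ) => hterm j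
  rw [Finset.sum_sub_distrib, Finset.sum_add_distrib, Finset.sum_ite_eq' Finset.univ i] at hsum
  simp only [Finset.sum_const, Finset.card_univ, Fintype.card_fin, nsmul_eq_mul, Finset.mem_univ,
    if_true] at hsum
  unfold setFF
  have hK : h (insert u K) = h K + x := by rw [hx]; ring
  rw [hK]
  nlinarith [hsum]

lemma setFF_ball_le {h : Finset (FG r) → ℝ}
    (hmono : ∀ K L, K ⊆ L → h K ≤ h L)
    (hsub : ∀ K L u, K ⊆ L → h (insert u L) + h K ≤ h (insert u K) + h L)
    (hinv : ∀ g K, h (K.image (g * ·)) = h K) (n : ℕ) :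
    setFF h (ballFinset r n) ≤ h {1} - r * h ∅ := by
  induction n with
  | zero =>
    have hj : ∀ j : Fin r, h ({1} ∪ Finset.image (FreeGroup.of j * ·) {1}) ≤ 2 * h {1} - h ∅ := by
      intro j
      have h1 := hsub ∅ (Finset.image (FreeGroup.of j * ·) {1}) 1 (Finset.empty_subset _)
      rw [hinv, insert_empty_eq] at h1
      rw [← Finset.insert_eq]
      linarith
    have hsum := Finset.sum_le_sum fun j (_ : j ∈ Finset.univ) => hj j
    simp only [Finset.sum_const, Finset.card_univ, Fintype.card_fin, nsmul_eq_mul] at hsum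
    rw [ballFinset_zero, setFF]
    nlinarith [hsum]
  | succ n ih =>
    have key : ∀ U : Finset (FG r), U ⊆ ballFinset r (n + 1) →
        setFF h (U ∪ ballFinset r n) ≤ setFF h (ballFinset r n) := by
      intro U
      induction U using Finset.induction_on with
      | empty => intro _; simp
      | insert u U _ ihU =>
        intro hU
        rw [Finset.insert_subset_iff] at hU
        refine le_trans ?_ (ihU hU.2)
        rw [Finset.insert_union]
        rcases exists_letter_mul (mem_ballFinset.1 hU.1) with hu | ⟨i, g, hg, hu⟩
        · rw [Finset.insert_eq_of_mem (Finset.mem_union_right _ hu)]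
        · exact setFF_insert_le hmono hsub hinv (Finset.mem_union_right _ hg) hu
    have hsubset : ballFinset r n ⊆ ballFinset r (n + 1) := fun g hg =>
      mem_ballFinset.2 ((mem_ballFinset.1 hg).trans n.le_succ)
    have := key _ subset_rfl
    rw [Finset.union_eq_left.2 hsubset] at this
    exact this.trans ih

end SetFunction

section Approximation

variable {X : Type*} [MeasurableSpace X] {μ : Measure X}

lemma Hpart_toReal_eq_sum [IsProbabilityMeasure μ] {I : Type*} [Fintype I] (f : X → I) :
    (Hpart μ f).toReal = ∑ i, Real.negMulLog (μ.real (f ⁻¹' {i})) := by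
  rw [Hpart, tsum_fintype, ENNReal.toReal_sum fun i _ => ENNReal.ofReal_ne_top]
  exact Finset.sum_congr rfl fun i _ => ENNReal.toReal_ofReal
    (Real.negMulLog_nonneg ENNReal.toReal_nonneg measureReal_le_one)

/-- Entropy of finite partitions is continuous with respect to convergence in measure. -/
lemma tendsto_Hpart_toReal [IsProbabilityMeasure μ] {I : Type*} [Finite I] [MeasurableSpace I]
    [MeasurableSingletonClass I] {f : X → I} {F : ℕ → X → I} (hf : Measurable f)
    (hF : ∀ n, Measurable (F n)) (h : Tendsto (fun n => μ.real {x | F n x ≠ f x}) atTop (nhds 0)) :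
    Tendsto (fun n => (Hpart μ (F n)).toReal) atTop (nhds (Hpart μ f).toReal) := by
  have := Fintype.ofFinite I
  simp only [Hpart_toReal_eq_sum]
  refine tendsto_finsetSum _ fun i _ => (Real.continuous_negMulLog.tendsto _).comp ?_
  rw [tendsto_iff_dist_tendsto_zero]
  refine squeeze_zero (fun _ => dist_nonneg) (fun n => ?_) h
  rw [Real.dist_eq]
  refine (abs_measureReal_sub_le_measureReal_symmDiff
    (hF n (measurableSet_singleton i)).nullMeasurableSet
    (hf (measurableSet_singleton i)).nullMeasurableSet).trans (measureReal_mono ?_)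
  rintro x (⟨h1, h2⟩ | ⟨h1, h2⟩) h3
  · exact h2 (h3.symm.trans h1)
  · exact h2 (h3.trans h1)

end Approximation

section Action

variable {r : ℕ} {X : Type*} [MeasurableSpace X] {μ : Measure X} {T : BorelAction (FG r) X}
  {a : X → ℕ}

lemma measurable_joinF (ha : Measurable a) (F : Set (FG r)) : Measurable (T.joinF F a) :=
  measurable_pi_iff.2 fun _ => ha.comp (T.measurable_act _)

lemma measurable_joinF_prodMk {I : Type*} [MeasurableSpace I] {γ : X → I} (ha : Measurable a)
    (hγ : Measurable γ) (K : Set (FG r)) :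
    Measurable fun x => (T.joinF K a x, γ x) :=
  (measurable_joinF ha _).prodMk hγ

lemma joinF_eq_iff {F : Set (FG r)} {x y : X} :
    T.joinF F a x = T.joinF F a y ↔ ∀ g ∈ F, a (T.act g⁻¹ x) = a (T.act g⁻¹ y) := by
  simp [funext_iff, BorelAction.joinF]

/-- The sets that are unions of cells of `F · a`. -/
def IsCellUnion (T : BorelAction (FG r) X) (a : X → ℕ) (F : Set (FG r)) (s : Set X) : Prop :=
  ∀ x y, T.joinF F a x = T.joinF F a y → (x ∈ s ↔ y ∈ s)

lemma IsCellUnion.mono {F F' : Set (FG r)} {s : Set X} (h : IsCellUnion T a F s) (hF : F ⊆ F') :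
    IsCellUnion T a F' s := fun x y hxy =>
  h x y (joinF_eq_iff.2 fun g hg => joinF_eq_iff.1 hxy g (hF hg))

lemma IsCellUnion.measurableSet (ha : Measurable a) {F : Set (FG r)} [Finite F] {s : Set X}
    (h : IsCellUnion T a F s) : MeasurableSet s := by
  have : s = T.joinF F a ⁻¹' (T.joinF F a '' s) := by
    ext x
    exact ⟨fun hx => ⟨x, hx, rfl⟩, fun ⟨y, hy, hyx⟩ => (h y x hyx).1 hy⟩
  rw [this]
  exact measurable_joinF ha F (Set.to_countable _).measurableSet

lemma ball_mono {m n : ℕ} (h : m ≤ n) : ball r m ⊆ ball r n := fun _ hg => le_trans hg h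

/-- A measurable set is approximated by unions of cells of the partitions `B_n · a` when `a` is
generating. -/
lemma exists_isCellUnion_measure_symmDiff_lt [IsProbabilityMeasure μ] (ha : Measurable a)
    (hgen : T.Generating a μ) {D : Set X} (hD : MeasurableSet D) {ε : ℝ≥0∞} (hε : 0 < ε) :
    ∃ s n, IsCellUnion T a (ball r n) s ∧ μ (s ∆ D) < ε := by
  set C : Set (Set X) := {s | ∃ n, IsCellUnion T a (ball r n) s} with hC
  have hring : IsSetRing C := by
    refine ⟨⟨0, fun x y _ => Iff.rfl⟩, ?_, ?_⟩
    · rintro s t ⟨m, hs⟩ ⟨n, ht⟩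
      refine ⟨max m n, fun x y hxy => ?_⟩
      rw [mem_union, mem_union, hs.mono (ball_mono (le_max_left m n)) x y hxy,
        ht.mono (ball_mono (le_max_right m n)) x y hxy]
    · rintro s t ⟨m, hs⟩ ⟨n, ht⟩
      refine ⟨max m n, fun x y hxy => ?_⟩
      rw [Set.mem_sdiff, Set.mem_sdiff, hs.mono (ball_mono (le_max_left m n)) x y hxy,
        ht.mono (ball_mono (le_max_right m n)) x y hxy]
  have hle : MeasurableSpace.generateFrom C ≤ ‹MeasurableSpace X› :=
    MeasurableSpace.generateFrom_le fun s ⟨n, hs⟩ => hs.measurableSet ha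
  have hpart : T.partSA Set.univ a ≤ MeasurableSpace.generateFrom C := by
    refine iSup₂_le fun g _ => ?_
    rintro _ ⟨U, -, rfl⟩
    refine MeasurableSpace.measurableSet_generateFrom ⟨wlen g, fun x y hxy => ?_⟩
    have := joinF_eq_iff.1 hxy g (show wlen g ≤ wlen g from le_rfl)
    simp [BorelAction.tr, this]
  obtain ⟨D', hD', hDD'⟩ := hgen D hD
  obtain ⟨s, ⟨n, hs⟩, hsε⟩ :=
    @exists_measure_symmDiff_lt_of_generateFrom_isSetRing X (MeasurableSpace.generateFrom C)
      (μ.trim hle) (isFiniteMeasure_trim hle) C hring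
      ⟨{univ}, countable_singleton _, by simpa using ⟨0, fun x y _ => Iff.rfl⟩, by simp⟩ rfl
      D' (hpart _ hD') ε hε
  refine ⟨s, n, hs, ?_⟩
  calc μ (s ∆ D) ≤ μ (s ∆ D') + μ (D' ∆ D) := measure_symmDiff_le _ _ _
    _ = μ (s ∆ D') := by rw [symmDiff_comm D', hDD', add_zero]
    _ ≤ (μ.trim hle) (s ∆ D') := le_trim hle
    _ < ε := hsε

/-- The conditional entropy of a finite partition given `B_n · a` can be made small when `a` is
generating. -/
lemma exists_condEntropy_le [IsProbabilityMeasure μ] (ha : Measurable a)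
    (hgen : T.Generating a μ) {k : ℕ} {D : Fin k → Set X} (hD : ∀ i, MeasurableSet (D i))
    {ε : ℝ} (hε : 0 < ε) :
    ∃ n, Hpart μ (fun x => (T.joinF (ball r n) a x, fun i => x ∈ D i)) ≤
      Hpart μ (T.joinF (ball r n) a) + ENNReal.ofReal ε := by
  choose s N hs hlt using fun (j : ℕ) (i : Fin k) => exists_isCellUnion_measure_symmDiff_lt
    (ε := ENNReal.ofReal (1 / ((j : ℝ) + 1))) ha hgen (hD i)
    (ENNReal.ofReal_pos.2 Nat.one_div_pos_of_nat)
  set γ : X → Fin k → Prop := fun x i => x ∈ D i with hγ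
  set γ' : ℕ → X → Fin k → Prop := fun j x i => x ∈ s j i with hγ'
  have mγ : Measurable γ := measurable_pi_iff.2 fun i => measurableSet_setOfPred.1 (hD i)
  have mγ' : ∀ j, Measurable (γ' j) := fun j =>
    measurable_pi_iff.2 fun i => measurableSet_setOfPred.1 ((hs j i).measurableSet ha)
  have hsmall : Tendsto (fun j => μ.real {x | γ' j x ≠ γ x}) atTop (nhds 0) := by
    refine squeeze_zero (g := fun j : ℕ => k * (1 / ((j : ℝ) + 1)))
      (fun _ => measureReal_nonneg) (fun j => ?_) ?_
    · have hsub : {x | γ' j x ≠ γ x} ⊆ ⋃ i, s j i ∆ D i := by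
        intro x hx
        by_contra hx'
        refine hx (funext fun i => propext ?_)
        simp only [mem_iUnion, not_exists, mem_symmDiff] at hx'
        have := hx' i
        show x ∈ s j i ↔ x ∈ D i
        tauto
      calc μ.real {x | γ' j x ≠ γ x} ≤ μ.real (⋃ i, s j i ∆ D i) := measureReal_mono hsub
        _ ≤ ∑ i, μ.real (s j i ∆ D i) := measureReal_iUnion_fintype_le _
        _ ≤ ∑ _i : Fin k, 1 / ((j : ℝ) + 1) := Finset.sum_le_sum fun i _ =>
            ENNReal.toReal_le_of_le_ofReal Nat.one_div_pos_of_nat.le (hlt j i).le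
        _ = k * (1 / ((j : ℝ) + 1)) := by simp
    · simpa using (tendsto_one_div_add_atTop_nhds_zero_nat (𝕜 := ℝ)).const_mul (k : ℝ)
  have hlim1 := tendsto_Hpart_toReal mγ mγ' hsmall
  have hlim2 : Tendsto (fun j => (Hpart μ (fun x => (γ' j x, γ x))).toReal) atTop
      (nhds (Hpart μ γ).toReal) := by
    have h := tendsto_Hpart_toReal (μ := μ) (mγ.prodMk mγ) (fun j => (mγ' j).prodMk mγ)
      (by simpa using hsmall)
    rwa [Hpart_congr_fibers (mγ.prodMk mγ) mγ (by simp)] at h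
  have hlim := hlim2.sub hlim1
  rw [sub_self] at hlim
  obtain ⟨j, hj⟩ := (hlim.eventually (gt_mem_nhds hε)).exists
  refine ⟨Finset.univ.sup (N j), ?_⟩
  set n := Finset.univ.sup (N j)
  have mb := measurable_joinF (T := T) ha (ball r n)
  have hsm := Hpart_submodular (μ := μ) ((mγ' j).prodMk mγ) mb (mγ' j)
    (fun x y hxy => congrArg Prod.fst hxy) (fun x y hxy => funext fun i => propext
      ((hs j i).mono (ball_mono (Finset.le_sup (Finset.mem_univ i))) x y hxy))
  have hmono : Hpart μ (fun x => (T.joinF (ball r n) a x, γ x)) ≤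
      Hpart μ (fun x => ((γ' j x, γ x), T.joinF (ball r n) a x)) :=
    Hpart_mono (mb.prodMk mγ) (((mγ' j).prodMk mγ).prodMk mb) (by simp +contextual)
  have hfin : Hpart μ (γ' j) ≠ ⊤ := (Hpart_lt_top _).ne
  have hle : Hpart μ (fun x => (γ' j x, γ x)) ≤ Hpart μ (γ' j) + ENNReal.ofReal ε := by
    rw [← ENNReal.ofReal_toReal hfin, ← ENNReal.ofReal_add ENNReal.toReal_nonneg hε.le,
      ← ENNReal.ofReal_toReal (Hpart_lt_top (μ := μ) fun x => (γ' j x, γ x)).ne]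
    exact ENNReal.ofReal_le_ofReal (by linarith)
  refine (ENNReal.add_le_add_iff_right hfin).1 ?_
  calc _ ≤ _ := add_le_add_left hmono _
    _ ≤ _ := hsm
    _ ≤ _ := add_le_add_left hle _
    _ = _ := by ring

end Action

section InvariantPartition

variable {r : ℕ} {X : Type*} [MeasurableSpace X] {μ : Measure X} [IsProbabilityMeasure μ]
  {T : BorelAction (FG r) X} {a : X → ℕ}
  {I : Type*} [Finite I] [MeasurableSpace I] [MeasurableSingletonClass I] {γ : X → I}

/-- The entropy of `K · a ∨ γ` for a finite set `K` of group elements. -/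
noncomputable def joinEnt (μ : Measure X) (T : BorelAction (FG r) X) (a : X → ℕ) (γ : X → I)
    (K : Finset (FG r)) : ℝ≥0∞ :=
  Hpart μ fun x => (T.joinF (K : Set (FG r)) a x, γ x)

lemma joinEnt_mono (ha : Measurable a) (hγ : Measurable γ) {K L : Finset (FG r)} (hKL : K ⊆ L) :
    joinEnt μ T a γ K ≤ joinEnt μ T a γ L := by
  refine Hpart_mono (measurable_joinF_prodMk ha hγ _) (measurable_joinF_prodMk ha hγ _)
    fun x y hxy => ?_
  simp only [Prod.mk.injEq, joinF_eq_iff] at hxy ⊢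
  exact ⟨fun g hg => hxy.1 g (hKL hg), hxy.2⟩

lemma joinEnt_submodular (ha : Measurable a) (hγ : Measurable γ) {K L : Finset (FG r)}
    (u : FG r) (hKL : K ⊆ L) :
    joinEnt μ T a γ (insert u L) + joinEnt μ T a γ K ≤
      joinEnt μ T a γ (insert u K) + joinEnt μ T a γ L := by
  have m := fun K : Finset (FG r) => measurable_joinF_prodMk (T := T) ha hγ (K : Set (FG r))
  refine le_trans (add_le_add_left (Hpart_mono (m _) ((m (insert u K)).prodMk (m L)) ?_) _)
    (Hpart_submodular (m (insert u K)) (m L) (m K) ?_ ?_)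
  · intro x y hxy
    simp only [Prod.mk.injEq, joinF_eq_iff, Finset.mem_coe, Finset.mem_insert] at hxy ⊢
    refine ⟨?_, hxy.1.2⟩
    rintro g (rfl | hg)
    exacts [hxy.1.1 _ (Or.inl rfl), hxy.2.1 g hg]
  · intro x y hxy
    simp only [Prod.mk.injEq, joinF_eq_iff, Finset.mem_coe, Finset.mem_insert] at hxy ⊢
    exact ⟨fun g hg => hxy.1 g (Or.inr hg), hxy.2⟩
  · intro x y hxy
    simp only [Prod.mk.injEq, joinF_eq_iff, Finset.mem_coe] at hxy ⊢
    exact ⟨fun g hg => hxy.1 g (hKL hg), hxy.2⟩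

lemma joinEnt_image (hT : T.Preserves μ) (ha : Measurable a) (hγ : Measurable γ)
    (hinv : ∀ g x, γ (T.act g x) = γ x) (s : FG r) (K : Finset (FG r)) :
    joinEnt μ T a γ (K.image (s * ·)) = joinEnt μ T a γ K := by
  have m := fun K : Finset (FG r) => measurable_joinF_prodMk (T := T) ha hγ (K : Set (FG r))
  rw [joinEnt, ← Hpart_comp (m _) (hT s)]
  refine Hpart_congr_fibers ((m _).comp (T.measurable_act s)) (m K) fun x y => ?_
  simp only [Function.comp_apply, Prod.mk.injEq, joinF_eq_iff, hinv, Finset.coe_image,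
    forall_mem_image, ← T.act_mul, mul_inv_rev, inv_mul_cancel_right]

lemma joinEnt_empty (ha : Measurable a) (hγ : Measurable γ) :
    joinEnt μ T a γ ∅ = Hpart μ γ :=
  Hpart_congr_fibers (measurable_joinF_prodMk ha hγ _) hγ fun x y => by
    simp only [Prod.mk.injEq, joinF_eq_iff]
    simp

lemma joinEnt_singleton_one_le (ha : Measurable a) (hγ : Measurable γ) :
    joinEnt μ T a γ {1} ≤ Hpart μ a + Hpart μ γ := by
  refine (Hpart_mono (measurable_joinF_prodMk ha hγ _) (ha.prodMk hγ) fun x y hxy => ?_).trans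
    (Hpart_prod_le ha hγ)
  simp only [Prod.mk.injEq, joinF_eq_iff] at hxy ⊢
  simpa [T.act_one] using hxy

lemma joinEnt_lt_top (hT : T.Preserves μ) (ha : Measurable a) (hγ : Measurable γ)
    (hinv : ∀ g x, γ (T.act g x) = γ x) (hH : Hpart μ a < ⊤) (K : Finset (FG r)) :
    joinEnt μ T a γ K < ⊤ := by
  induction K using Finset.induction_on with
  | empty =>
    rw [joinEnt_empty ha hγ]
    exact Hpart_lt_top γ
  | insert u K _ ih =>
    refine lt_of_le_of_lt (le_self_add.trans (joinEnt_submodular ha hγ u (Finset.empty_subset K)))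
      (ENNReal.add_lt_top.2 ⟨?_, ih⟩)
    have h := joinEnt_image hT ha hγ hinv u {1}
    rw [Finset.image_singleton, mul_one] at h
    rw [insert_empty_eq, h]
    exact (joinEnt_singleton_one_le ha hγ).trans_lt (ENNReal.add_lt_top.2 ⟨hH, Hpart_lt_top γ⟩)

/-- A lower bound on the `f`-invariant bounds the entropy of the finite invariant partitions. -/
theorem Hpart_invariant_le (hr : 1 < r) (hT : T.Preserves μ) (ha : Measurable a)
    (hgen : T.Generating a μ) (hH : Hpart μ a < ⊤) {b : ℝ} (hb : ∀ n, b ≤ fSeq μ T a n)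
    {k : ℕ} {D : Fin k → Set X} (hD : ∀ i, MeasurableSet (D i))
    (hinv : ∀ i g, T.act g ⁻¹' D i = D i) :
    Hpart μ (fun x i => x ∈ D i) ≤ ENNReal.ofReal ((Hpart μ a).toReal - b) := by
  set γ : X → Fin k → Prop := fun x i => x ∈ D i with hγdef
  have hγ : Measurable γ := measurable_pi_iff.2 fun i => measurableSet_setOfPred.1 (hD i)
  have hγinv : ∀ g x, γ (T.act g x) = γ x := fun g x => funext fun i =>
    congrArg (x ∈ ·) (hinv i g)
  have hfin := joinEnt_lt_top hT ha hγ hγinv hH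
  set h : Finset (FG r) → ℝ := fun K => (joinEnt μ T a γ K).toReal with hh
  have hmono : ∀ K L, K ⊆ L → h K ≤ h L := fun K L hKL =>
    ENNReal.toReal_mono (hfin L).ne (joinEnt_mono ha hγ hKL)
  have hsub : ∀ K L u, K ⊆ L → h (insert u L) + h K ≤ h (insert u K) + h L := by
    intro K L u hKL
    have := ENNReal.toReal_mono (ENNReal.add_lt_top.2 ⟨hfin _, hfin _⟩).ne
      (joinEnt_submodular (μ := μ) (T := T) ha hγ u hKL)
    rwa [ENNReal.toReal_add (hfin _).ne (hfin _).ne,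
      ENNReal.toReal_add (hfin _).ne (hfin _).ne] at this
  have himage : ∀ g K, h (K.image (g * ·)) = h K := fun g K => by
    simp only [hh, joinEnt_image hT ha hγ hγinv]
  have hempty : h ∅ = (Hpart μ γ).toReal := by simp only [hh, joinEnt_empty ha hγ]
  have hγfin : Hpart μ γ < ⊤ := Hpart_lt_top γ
  have hone : h {1} ≤ (Hpart μ a).toReal + (Hpart μ γ).toReal := by
    rw [← ENNReal.toReal_add hH.ne hγfin.ne]
    exact ENNReal.toReal_mono (ENNReal.add_lt_top.2 ⟨hH, hγfin⟩).ne
      (joinEnt_singleton_one_le ha hγ)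
  have hr' : (2 : ℝ) ≤ r := by exact_mod_cast hr
  have key : ∀ ε : ℝ, 0 < ε →
      b - (2 * r - 1) * ε ≤ (Hpart μ a).toReal - (r - 1) * (Hpart μ γ).toReal := by
    intro ε hε
    obtain ⟨n, hn⟩ := exists_condEntropy_le ha hgen hD hε
    have hball := setFF_ball_le hmono hsub himage n
    have mball := measurable_joinF (T := T) ha (ball r n)
    have hB : joinEnt μ T a γ (ballFinset r n) =
        Hpart μ (fun x => (T.joinF (ball r n) a x, γ x)) :=
      Hpart_congr_fibers (measurable_joinF_prodMk ha hγ _) (mball.prodMk hγ) fun x y => by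
        simp only [Prod.mk.injEq, joinF_eq_iff]
        simp [ballFinset]
    have hβfin : Hpart μ (T.joinF (ball r n) a) < ⊤ := by
      refine (Hpart_mono mball (mball.prodMk hγ) fun x y hxy => congrArg Prod.fst hxy).trans_lt ?_
      rw [← hB]
      exact hfin _
    have hBle : h (ballFinset r n) ≤ (Hpart μ (T.joinF (ball r n) a)).toReal + ε := by
      rw [← hB] at hn
      have := ENNReal.toReal_mono (ENNReal.add_lt_top.2 ⟨hβfin, ENNReal.ofReal_lt_top⟩).ne hn
      rwa [ENNReal.toReal_add hβfin.ne ENNReal.ofReal_ne_top, ENNReal.toReal_ofReal hε.le] at this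
    have hstep : ∀ i : Fin r, (Hpart μ (fun x => (T.tr (FreeGroup.of i) (T.joinF (ball r n) a) x,
        T.joinF (ball r n) a x))).toReal ≤
        h (ballFinset r n ∪ (ballFinset r n).image (FreeGroup.of i * ·)) := by
      intro i
      refine ENNReal.toReal_mono (hfin _).ne (Hpart_mono
        ((mball.comp (T.measurable_act _)).prodMk mball)
        (measurable_joinF_prodMk ha hγ _) fun x y hxy => ?_)
      simp only [Prod.mk.injEq, joinF_eq_iff, BorelAction.tr] at hxy ⊢
      constructor
      · intro g hg
        have := hxy.1 (FreeGroup.of i * g) (by simpa [ballFinset] using Or.inr hg)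
        simpa only [mul_inv_rev, T.act_mul] using this
      · intro g hg
        exact hxy.1 g (by simpa [ballFinset] using Or.inl hg)
    have hsum := Finset.sum_le_sum fun i (_ : i ∈ Finset.univ) => hstep i
    have hbn := hb n
    rw [fSeq, FF] at hbn
    rw [setFF] at hball
    rw [hempty] at hball
    nlinarith [mul_le_mul_of_nonneg_left hBle (by linarith : (0 : ℝ) ≤ 2 * r - 1)]
  have hle : (r - 1) * (Hpart μ γ).toReal ≤ (Hpart μ a).toReal - b := by
    refine le_of_forall_pos_le_add fun δ hδ => ?_
    have hpos : (0 : ℝ) < 2 * r - 1 := by linarith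
    have := key (δ / (2 * r - 1)) (div_pos hδ hpos)
    rw [mul_div_cancel₀ _ hpos.ne'] at this
    linarith
  rw [← ENNReal.ofReal_toReal hγfin.ne]
  refine ENNReal.ofReal_le_ofReal ?_
  nlinarith [ENNReal.toReal_nonneg (a := Hpart μ γ)]

end InvariantPartition

section ErgodicDecomposition

open ProbabilityTheory

/-- Disintegration along a sub-σ-algebra `m`: the conditional expectation kernel integrates the
`m`-measurable densities correctly. -/
lemma lintegral_mul_condExpKernel {X : Type*} {m : MeasurableSpace X} [mX : MeasurableSpace X]
    [StandardBorelSpace X] {μ : Measure X} [IsFiniteMeasure μ] (hm : m ≤ mX) {ρ : X → ℝ≥0∞}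
    (hρ : Measurable[m] ρ) {B : Set X} (hB : MeasurableSet B) :
    ∫⁻ x, ρ x * condExpKernel μ m x B ∂μ = ∫⁻ x in B, ρ x ∂μ := by
  have hf : @Measurable (X × X) ℝ≥0∞ (m.prod mX) _
      (fun p => ρ p.1 * B.indicator (fun _ => 1) p.2) :=
    (hρ.comp measurable_fst).mul ((measurable_const.indicator hB).comp measurable_snd)
  have hd : @Measurable X (X × X) mX (m.prod mX) Function.diag :=
    (measurable_id'' hm).prodMk measurable_id
  have h := congrArg (fun P => @lintegral (X × X) (m.prod mX) P
    (fun p => ρ p.1 * B.indicator (fun _ => 1) p.2)) (compProd_trim_condExpKernel (μ := μ) hm)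
  rw [@Measure.lintegral_compProd X X m mX _ _ _ _ _ hf,
    @lintegral_map X (X × X) mX (m.prod mX) μ _ _ hf hd] at h
  have h1 : ∀ x, ∫⁻ y, ρ x * B.indicator (fun _ => 1) y ∂condExpKernel μ m x =
      ρ x * condExpKernel μ m x B := fun x => by
    rw [lintegral_const_mul _ (measurable_const.indicator hB), lintegral_indicator_const hB,
      one_mul]
  simp only [h1] at h
  rw [lintegral_trim hm (hρ.fun_mul (measurable_condExpKernel hB))] at h
  rw [h, ← lintegral_indicator hB]
  refine lintegral_congr fun x => ?_
  by_cases hx : x ∈ B <;> simp [hx, Function.diag]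

variable {G X : Type*} [Group G] [mX : MeasurableSpace X]

/-- The σ-algebra of invariant Borel sets. -/
@[reducible] def BorelAction.invSA (T : BorelAction G X) : MeasurableSpace X where
  MeasurableSet' s := MeasurableSet s ∧ ∀ g, T.act g ⁻¹' s = s
  measurableSet_empty := ⟨MeasurableSet.empty, fun _ => rfl⟩
  measurableSet_compl s hs := ⟨hs.1.compl, fun g => by rw [preimage_compl, hs.2 g]⟩
  measurableSet_iUnion s hs := ⟨MeasurableSet.iUnion fun i => (hs i).1, fun g => by
    rw [preimage_iUnion]; exact iUnion_congr fun i => (hs i).2 g⟩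

lemma BorelAction.invSA_le (T : BorelAction G X) : T.invSA ≤ mX := fun _ hs => hs.1

/-- The density of an invariant measure with respect to an invariant measure is invariant. -/
lemma exists_invariant_density [Countable G] {T : BorelAction G X} {μ ν : Measure X}
    [IsFiniteMeasure μ] [IsFiniteMeasure ν] (hμ : T.Preserves μ) (hν : T.Preserves ν) (h : ν ≪ μ) :
    ∃ ρ : X → ℝ≥0∞, Measurable[T.invSA] ρ ∧ ν = μ.withDensity ρ := by
  set ρ := ν.rnDeriv μ
  have hρ : Measurable ρ := Measure.measurable_rnDeriv ν μ
  have hd : μ.withDensity ρ = ν := Measure.withDensity_rnDeriv_eq ν μ h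
  have hac : ∀ g, ρ ∘ T.act g =ᵐ[μ] ρ := fun g => by
    refine (ae_eq_of_forall_setLIntegral_eq_of_sigmaFinite (hρ.comp (T.measurable_act g)) hρ
      fun s hs _ => ?_)
    have hs' : T.act g ⁻¹' (T.act g⁻¹ ⁻¹' s) = s := by
      ext x; simp [← T.act_mul, T.act_one]
    have hm : MeasurableSet (T.act g⁻¹ ⁻¹' s) := T.measurable_act _ hs
    have h1 := (hμ g).setLIntegral_comp_preimage hm hρ
    rw [hs'] at h1
    have h2 := withDensity_apply ρ hs (μ := μ)
    rw [hd] at h2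
    simp only [Function.comp_apply]
    rw [← h2, h1, ← withDensity_apply _ hm, hd, (hν g⁻¹).measure_preimage hs.nullMeasurableSet]
  refine ⟨fun x => ⨆ g, ρ (T.act g x), ?_, ?_⟩
  · have hm : Measurable fun x => ⨆ g, ρ (T.act g x) :=
      Measurable.iSup fun g => hρ.comp (T.measurable_act g)
    intro s hs
    refine ⟨hm hs, fun g => ?_⟩
    ext x
    have : ⨆ h, ρ (T.act h (T.act g x)) = ⨆ h, ρ (T.act h x) := by
      simp only [← T.act_mul]
      exact (Equiv.mulRight g).iSup_congr fun _ => rfl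
    simp only [mem_preimage, this]
  · rw [← hd]
    refine withDensity_congr_ae ?_
    filter_upwards [ae_all_iff.2 hac] with x hx
    simp only [Function.comp_apply] at hx
    simp [hx]

/-- Averages of an invariant measure absolutely continuous to `μ` can be computed through the
conditional expectation kernel. -/
lemma lintegral_condExpKernel_invSA [Countable G] [StandardBorelSpace X] {T : BorelAction G X}
    {μ ν : Measure X} [IsFiniteMeasure μ] [IsFiniteMeasure ν] (hμ : T.Preserves μ)
    (hν : T.Preserves ν) (h : ν ≪ μ) {B : Set X} (hB : MeasurableSet B) :
    ∫⁻ x, condExpKernel μ T.invSA x B ∂ν = ν B := by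
  obtain ⟨ρ, hρ, rfl⟩ := exists_invariant_density hμ hν h
  rw [withDensity_apply _ hB, ← lintegral_mul_condExpKernel T.invSA_le hρ hB,
    lintegral_withDensity_eq_lintegral_mul _ (hρ.mono T.invSA_le le_rfl)
      ((measurable_condExpKernel hB).mono T.invSA_le le_rfl)]
  rfl

lemma ae_mem_of_measure_eq_one {M : Type*} [MeasurableSpace M] {τ : Measure M}
    [IsProbabilityMeasure τ] {s t : Set M} (hs : τ s = 1) (hst : s ⊆ t) (ht : MeasurableSet t) :
    ∀ᵐ ν ∂τ, ν ∈ t :=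
  (mem_ae_iff_prob_eq_one ht).2 (le_antisymm prob_le_one (hs ▸ measure_mono hst))

lemma ae_isProbabilityMeasure {T : BorelAction G X} {τ : Measure (Measure X)}
    [IsProbabilityMeasure τ] (hconc : τ (InvProb T) = 1) : ∀ᵐ ν ∂τ, IsProbabilityMeasure ν := by
  have h : ∀ᵐ ν ∂τ, ν ∈ {ν : Measure X | ν univ = 1} :=
    ae_mem_of_measure_eq_one hconc (fun ν hν => hν.1.measure_univ)
      (Measure.measurable_coe MeasurableSet.univ (measurableSet_singleton 1))
  filter_upwards [h] with ν hν using ⟨hν⟩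

lemma ae_measure_preimage_act {T : BorelAction G X} {τ : Measure (Measure X)}
    [IsProbabilityMeasure τ] (hconc : τ (InvProb T) = 1) (g : G) {B : Set X}
    (hB : MeasurableSet B) : ∀ᵐ ν ∂τ, ν (T.act g ⁻¹' B) = ν B :=
  ae_mem_of_measure_eq_one (t := {ν : Measure X | ν (T.act g ⁻¹' B) = ν B}) hconc
    (fun _ hν => (hν.2 g).measure_preimage hB.nullMeasurableSet)
    (measurableSet_eq_fun (Measure.measurable_coe (T.measurable_act g hB))
      (Measure.measurable_coe hB))

/-- Almost every component of a decomposition of `μ` into invariant measures is averaged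
correctly by the conditional expectation kernel of `μ`. -/
lemma ae_lintegral_condExpKernel [Countable G] [StandardBorelSpace X] {T : BorelAction G X}
    {μ : Measure X} [IsFiniteMeasure μ] (hμ : T.Preserves μ) {τ : Measure (Measure X)}
    [IsProbabilityMeasure τ] (hconc : τ (InvProb T) = 1)
    (hdec : ∀ B : Set X, MeasurableSet B → μ B = ∫⁻ ν, ν B ∂τ) {B : Set X}
    (hB : MeasurableSet B) :
    ∀ᵐ ν ∂τ, ∫⁻ x, condExpKernel μ T.invSA x B ∂ν = ν B := by
  have hκ : Measurable fun x => condExpKernel μ T.invSA x B :=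
    (measurable_condExpKernel hB).mono T.invSA_le le_rfl
  refine ae_eq_of_forall_setLIntegral_eq_of_sigmaFinite (Measure.measurable_lintegral hκ)
    (Measure.measurable_coe hB) fun s hs _ => ?_
  have hle : (τ.restrict s).join ≤ μ := Measure.le_iff.2 fun C hC => by
    rw [Measure.join_apply hC, hdec C hC]
    exact lintegral_mono' Measure.restrict_le_self le_rfl
  have : IsFiniteMeasure (τ.restrict s).join := isFiniteMeasure_of_le μ hle
  have hinv : T.Preserves (τ.restrict s).join := fun g => ⟨T.measurable_act g, by
    ext C hC
    rw [Measure.map_apply (T.measurable_act g) hC, Measure.join_apply (T.measurable_act g hC),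
      Measure.join_apply hC]
    exact lintegral_congr_ae (ae_restrict_of_ae (ae_measure_preimage_act hconc g hC))⟩
  have h := lintegral_condExpKernel_invSA hμ hinv (Measure.absolutelyContinuous_of_le hle) hB
  rwa [Measure.join_apply hB, Measure.lintegral_join hκ.aemeasurable] at h

/-- An ergodic measure gives trivial mass to the strictly invariant Borel sets. -/
lemma ae_measure_invSA_eq {T : BorelAction G X} {τ : Measure (Measure X)}
    [IsProbabilityMeasure τ] (herg : τ {ν | T.IsErgodic ν} = 1) {D : Set X}
    (hD : MeasurableSet[T.invSA] D) : ∀ᵐ ν ∂τ, ν D = 0 ∨ ν D = 1 := by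
  refine ae_mem_of_measure_eq_one (t := {ν : Measure X | ν D = 0 ∨ ν D = 1}) herg
    (fun ν hν => hν D hD.1 fun g => ?_) (MeasurableSet.union ?_ ?_)
  · rw [BorelAction.smulSet, hD.2, symmDiff_self]
    exact measure_empty
  · exact Measure.measurable_coe hD.1 (measurableSet_singleton 0)
  · exact Measure.measurable_coe hD.1 (measurableSet_singleton 1)

lemma exists_countable_isPiSystem [MeasurableSpace.CountablyGenerated X] :
    ∃ A : Set (Set X), A.Countable ∧ A.Nonempty ∧ IsPiSystem A ∧
      mX = MeasurableSpace.generateFrom A :=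
  ⟨generateSetAlgebra (MeasurableSpace.countableGeneratingSet X),
    countable_generateSetAlgebra MeasurableSpace.countable_countableGeneratingSet,
    ⟨∅, isSetAlgebra_generateSetAlgebra.empty_mem⟩,
    fun _ hs _ ht _ => isSetAlgebra_generateSetAlgebra.inter_mem hs ht, by
      rw [generateFrom_generateSetAlgebra_eq, MeasurableSpace.generateFrom_countableGeneratingSet]⟩

/-- A sequence of measurable sets of measures separates the probability measures on a
countably generated space. -/
lemma exists_seq_separating_measure [MeasurableSpace.CountablyGenerated X] :
    ∃ e : ℕ → Set (Measure X), (∀ i, MeasurableSet (e i)) ∧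
      ∀ ν ν' : Measure X, IsProbabilityMeasure ν → IsProbabilityMeasure ν' →
        (∀ i, ν ∈ e i ↔ ν' ∈ e i) → ν = ν' := by
  obtain ⟨A, hA, hne, hpi, hgen⟩ := exists_countable_isPiSystem (X := X)
  have hAm : ∀ B ∈ A, MeasurableSet B := fun B hB => by
    rw [hgen]; exact MeasurableSpace.measurableSet_generateFrom hB
  set E := (fun p : Set X × ℝ≥0∞ => {ν : Measure X | p.2 < ν p.1}) ''
    (A ×ˢ range fun q : ℚ => ENNReal.ofReal q)
  have hE : E.Countable := (hA.prod (countable_range _)).image _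
  obtain ⟨e, he⟩ := hE.exists_eq_range ((hne.prod (range_nonempty _)).image _)
  refine ⟨e, fun i => ?_, fun ν ν' hν hν' h => ?_⟩
  · obtain ⟨p, hp, hpe⟩ : e i ∈ E := he ▸ mem_range_self i
    rw [← hpe]
    exact Measure.measurable_coe (hAm _ hp.1) measurableSet_Ioi
  · have hle : ∀ B ∈ A, ∀ q : ℚ, ENNReal.ofReal q < ν B ↔ ENNReal.ofReal q < ν' B := by
      intro B hB q
      obtain ⟨i, hi⟩ : {ν : Measure X | ENNReal.ofReal q < ν B} ∈ range e :=
        he ▸ ⟨(B, ENNReal.ofReal q), ⟨hB, mem_range_self q⟩, rfl⟩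
      have := h i
      rwa [hi] at this
    refine ext_of_generate_finite A hgen hpi (fun B hB => ?_)
      (by rw [hν.measure_univ, hν'.measure_univ])
    have key : ∀ a b : ℝ≥0∞, (∀ q : ℚ, ENNReal.ofReal q < b → ENNReal.ofReal q < a) → b ≤ a := by
      intro a b hab
      by_contra! hlt
      obtain ⟨q, _, hq1, hq2⟩ := ENNReal.lt_iff_exists_rat_btwn.1 hlt
      exact lt_asymm hq1 (hab q hq2)
    exact le_antisymm (key _ _ fun q => (hle B hB q).1) (key _ _ fun q => (hle B hB q).2)

/-- The conditional expectation kernel given the invariant sets is almost surely constant along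
almost every component of an ergodic decomposition, with value the component itself. -/
lemma ae_condExpKernel_ae_eq [Countable G] [StandardBorelSpace X] {T : BorelAction G X}
    {μ : Measure X} [IsFiniteMeasure μ] (hμ : T.Preserves μ) {τ : Measure (Measure X)}
    [IsProbabilityMeasure τ] (hconc : τ (InvProb T) = 1) (herg : τ {ν | T.IsErgodic ν} = 1)
    (hdec : ∀ B : Set X, MeasurableSet B → μ B = ∫⁻ ν, ν B ∂τ) :
    ∀ᵐ ν ∂τ, ∀ᵐ x ∂ν, condExpKernel μ T.invSA x = ν := by
  obtain ⟨A, hA, -, hpi, hgen⟩ := exists_countable_isPiSystem (X := X)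
  obtain ⟨e, he, hsep⟩ := exists_seq_separating_measure (X := X)
  have hκ : Measurable[T.invSA] fun x => condExpKernel μ T.invSA x :=
    (condExpKernel μ T.invSA).measurable
  have h1 : ∀ᵐ ν ∂τ, ∀ B ∈ A, ∫⁻ x, condExpKernel μ T.invSA x B ∂ν = ν B :=
    (ae_ball_iff hA).2 fun B hB => ae_lintegral_condExpKernel hμ hconc hdec
      (by rw [hgen]; exact MeasurableSpace.measurableSet_generateFrom hB)
  have h2 : ∀ᵐ ν ∂τ, ∀ i, ν ((fun x => condExpKernel μ T.invSA x) ⁻¹' e i) = 0 ∨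
      ν ((fun x => condExpKernel μ T.invSA x) ⁻¹' e i) = 1 :=
    ae_all_iff.2 fun i => ae_measure_invSA_eq herg (hκ (he i))
  filter_upwards [h1, h2, ae_isProbabilityMeasure hconc] with ν hν1 hν2 hν3
  have : HasCountableSeparatingOn (Measure X) (· ∈ range e) {ν | IsProbabilityMeasure ν} :=
    ⟨⟨range e, countable_range e, fun _ h => h, fun ν hν ν' hν' h =>
      hsep ν ν' hν hν' fun i => h _ (mem_range_self i)⟩⟩
  obtain ⟨m, hm, hconst⟩ :=
    exists_mem_eventuallyEq_const_of_eventually_mem_of_forall_separating (l := ae ν)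
      (f := fun x => condExpKernel μ T.invSA x) (s := {ν | IsProbabilityMeasure ν})
      (· ∈ range e) (Eventually.of_forall fun x => inferInstanceAs
        (IsProbabilityMeasure (condExpKernel μ T.invSA x))) ⟨ν, hν3⟩ (by
        rintro _ ⟨i, rfl⟩
        have hmeas : MeasurableSet ((fun x => condExpKernel μ T.invSA x) ⁻¹' e i) :=
          T.invSA_le _ (hκ (he i))
        rcases hν2 i with h | h
        · exact Or.inr (measure_eq_zero_iff_ae_notMem.1 h)
        · exact Or.inl ((mem_ae_iff_prob_eq_one hmeas).2 h))
  have hmν : m = ν := by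
    have hm' : IsProbabilityMeasure m := hm
    refine ext_of_generate_finite A hgen hpi (fun B hB => ?_) (by simp)
    rw [← hν1 B hB, lintegral_congr_ae (hconst.mono fun x hx => congrArg (fun P => P B) hx)]
    simp
  filter_upwards [hconst] with x hx
  rw [hx, hmν, Function.const_apply]

/-- An ergodic decomposition is the distribution of the conditional expectation kernel. -/
lemma measure_preimage_condExpKernel [Countable G] [StandardBorelSpace X] {T : BorelAction G X}
    {μ : Measure X} [IsFiniteMeasure μ] (hμ : T.Preserves μ) {τ : Measure (Measure X)}
    [IsProbabilityMeasure τ] (hconc : τ (InvProb T) = 1) (herg : τ {ν | T.IsErgodic ν} = 1)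
    (hdec : ∀ B : Set X, MeasurableSet B → μ B = ∫⁻ ν, ν B ∂τ) {U : Set (Measure X)}
    (hU : MeasurableSet U) : μ {x | condExpKernel μ T.invSA x ∈ U} = τ U := by
  have hmeas : MeasurableSet {x | condExpKernel μ T.invSA x ∈ U} :=
    T.invSA_le _ ((condExpKernel μ T.invSA).measurable hU)
  rw [hdec _ hmeas, ← lintegral_indicator_one hU]
  refine lintegral_congr_ae ?_
  filter_upwards [ae_condExpKernel_ae_eq hμ hconc herg hdec, ae_isProbabilityMeasure hconc]
    with ν hν hν'
  by_cases h : ν ∈ U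
  · rw [indicator_of_mem h, Pi.one_apply, ← mem_ae_iff_prob_eq_one hmeas]
    filter_upwards [hν] with x hx
    simpa [hx] using h
  · rw [indicator_of_notMem h, measure_eq_zero_iff_ae_notMem]
    filter_upwards [hν] with x hx
    simpa [hx] using h

end ErgodicDecomposition

/-- If a sequence of measurable sets separates almost all points and the finite partitions it
generates have bounded entropy, then almost every point is an atom. -/
lemma ae_pos_measure_singleton_of_Hpart_le {M : Type*} [MeasurableSpace M] {τ : Measure M}
    [IsProbabilityMeasure τ] {e : ℕ → Set M} (he : ∀ i, MeasurableSet (e i)) {P : Set M}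
    (hP : ∀ᵐ x ∂τ, x ∈ P) (hsep : ∀ x ∈ P, ∀ y ∈ P, (∀ i, x ∈ e i ↔ y ∈ e i) → x = y)
    {C : ℝ≥0∞} (hC : C ≠ ⊤)
    (hH : ∀ n : ℕ, Hpart τ (fun x (i : Fin n) => x ∈ e i) ≤ C) :
    ∀ᵐ x ∂τ, 0 < τ {x} := by
  have hm : ∀ n : ℕ, Measurable fun x (i : Fin n) => x ∈ e i := fun n =>
    measurable_pi_iff.2 fun i => measurableSet_setOfPred.1 (he i)
  have hfin : ∀ᵐ x ∂τ, liminf (fun n => info τ (fun x (i : Fin n) => x ∈ e i) x) atTop < ⊤ := by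
    refine ae_lt_top (Measurable.liminf fun n => measurable_info (hm n)) (ne_top_of_le_ne_top hC ?_)
    refine (lintegral_liminf_le fun n => measurable_info (hm n)).trans ?_
    exact liminf_le_of_le (h := fun b hb => by
      obtain ⟨n, hn⟩ := hb.exists
      exact hn.trans ((Hpart_eq_lintegral (hm n)).symm.le.trans (hH n)))
  filter_upwards [hfin, hP, ae_all_iff.2 fun n : ℕ =>
    ae_measure_fiber_ne_zero (μ := τ) (fun x (i : Fin n) => x ∈ e i)] with x hx hxP hne
  by_contra h0
  rw [not_lt, nonpos_iff_eq_zero] at h0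
  set c : ℕ → Set M := fun n => (fun x (i : Fin n) => x ∈ e i) ⁻¹' {fun i : Fin n => x ∈ e i}
  have hc : ∀ n y, y ∈ c n ↔ ∀ i < n, (y ∈ e i ↔ x ∈ e i) := fun n y => by
    simp only [c, mem_preimage, mem_singleton_iff, funext_iff, eq_iff_iff]
    exact ⟨fun h i hi => h ⟨i, hi⟩, fun h i => h i i.2⟩
  have hlim : Tendsto (fun n => τ (c n)) atTop (nhds 0) := by
    have h := tendsto_measure_iInter_atTop (μ := τ) (s := c)
      (fun n => (hm n (measurableSet_singleton _)).nullMeasurableSet)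
      (fun m n hmn y hy => (hc m y).2 fun i hi => (hc n y).1 hy i (hi.trans_le hmn))
      ⟨0, measure_ne_top _ _⟩
    have hz : τ (⋂ n, c n) = 0 := by
      refine measure_mono_null_ae ?_ h0
      filter_upwards [hP] with y hy hyc
      exact hsep y hy x hxP fun i => (hc (i + 1) y).1 (mem_iInter.1 hyc _) i i.lt_succ_self
    rwa [hz] at h
  have hlim' : Tendsto (fun n => (τ (c n)).toReal) atTop (nhdsWithin 0 (Ioi 0)) :=
    tendsto_nhdsWithin_iff.2 ⟨(ENNReal.tendsto_toReal ENNReal.zero_ne_top).comp hlim,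
      Eventually.of_forall fun n => ENNReal.toReal_pos (hne n) (measure_ne_top _ _)⟩
  have hinfo : Tendsto (fun n => info τ (fun x (i : Fin n) => x ∈ e i) x) atTop (nhds ⊤) :=
    ENNReal.tendsto_ofReal_atTop.comp
      (tendsto_neg_atBot_atTop.comp (Real.tendsto_log_nhdsGT_zero.comp hlim'))
  exact hx.ne hinfo.liminf_eq

/-- If the f-invariant entropy is finite then the ergodic decomposition
is purely atomic, so there are only countably many ergodic components. -/
theorem statement4 {r : ℕ} (hr : 1 < r) {X : Type*}
    [mX : MeasurableSpace X] [StandardBorelSpace X]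
    (μ : Measure X) [IsProbabilityMeasure μ]
    (T : BorelAction (FG r) X) (hT : T.Preserves μ)
    (hdef : ∃ a : X → ℕ, Measurable a ∧ T.Generating a μ ∧ Hpart μ a < ⊤ ∧
      fInv μ T a ≠ ⊥)
    (τ : Measure (Measure X)) [IsProbabilityMeasure τ]
    (hconc : τ (InvProb T) = 1)
    (hergm : τ {ν | T.IsErgodic ν} = 1)
    (hdec : ∀ B : Set X, MeasurableSet B → μ B = ∫⁻ ν, ν B ∂τ) :
    τ {ν | 0 < τ {ν}} = 1 := by
  obtain ⟨a, ha, hgen, hH, hf⟩ := hdef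
  have hb : ∀ n, (fInv μ T a).toReal ≤ fSeq μ T a n := fun n => by
    have hle : fInv μ T a ≤ (fSeq μ T a n : EReal) := iInf_le _ n
    exact_mod_cast (EReal.coe_toReal_le hf).trans hle
  obtain ⟨e, he, hsep⟩ := exists_seq_separating_measure (X := X)
  have hae : ∀ᵐ ν ∂τ, 0 < τ {ν} := by
    refine ae_pos_measure_singleton_of_Hpart_le
      (C := ENNReal.ofReal ((Hpart μ a).toReal - (fInv μ T a).toReal)) he
      (ae_isProbabilityMeasure hconc) (fun ν hν ν' hν' => hsep ν ν' hν hν')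
      ENNReal.ofReal_ne_top fun n => ?_
    refine le_of_eq_of_le ?_ (Hpart_invariant_le hr hT ha hgen hH hb
      (D := fun i : Fin n => {x | ProbabilityTheory.condExpKernel μ T.invSA x ∈ e i}) ?_ ?_)
    · refine tsum_congr fun i => ?_
      have hm : Measurable fun (ν : Measure X) (i : Fin n) => ν ∈ e i :=
        measurable_pi_iff.2 fun i => measurableSet_setOfPred.1 (he i)
      rw [← measure_preimage_condExpKernel hT hconc hergm hdec (hm (measurableSet_singleton i))]
      rfl
    · exact fun i => ((ProbabilityTheory.condExpKernel μ T.invSA).measurable (he i)).1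
    · exact fun i => ((ProbabilityTheory.condExpKernel μ T.invSA).measurable (he i)).2
  rw [measure_eq_measure_of_null_sdiff (subset_univ _) (by rwa [← compl_eq_univ_sdiff]),
    measure_univ]

end FPaper
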